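/- The strong duality equalities hold: k*(ε,y0) = μ*(ε,y0) for every ε ∈ (0,1) and every y0 ∈ Y, and k* = μ*. -/

import Mathlib

open MeasureTheory Filter Set Topology
open scoped ENNReal NNReal

noncomputable section

namespace StochLP

/-- The model of the controlled stochastic discrete time system (controlled stochastic
recursion) `y(t+1) = f(y(t), u(t), s(t))` from the paper: `Y ⊂ ℝⁿ` is a compact forward
invariant state constraint set, `Uc` is a compact metric control space, `S` is a Polish
noise space, `U` is an upper semicontinuous compact valued control constraint
multifunction (upper semicontinuity of a compact valued map into a compact space being
recorded as closedness of its graph), `f` is bounded, continuous in `(y,u)` and Borel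
measurable in `s`, and `ν` is the common law of the i.i.d. noise elements `s(t)`. -/
structure Model (n : ℕ) (Uc S : Type) [MetricSpace Uc] [CompactSpace Uc]
    [MeasurableSpace Uc] [BorelSpace Uc] [TopologicalSpace S] [PolishSpace S]
    [MeasurableSpace S] [BorelSpace S] where
  Y : Set (Fin n → ℝ)
  U : (Fin n → ℝ) → Set Uc
  f : (Fin n → ℝ) → Uc → S → (Fin n → ℝ)
  ν : Measure S
  ν_prob : IsProbabilityMeasure ν
  Y_compact : IsCompact Y
  Y_nonempty : Y.Nonempty
  U_nonempty : ∀ y ∈ Y, (U y).Nonempty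
  U_compact : ∀ y ∈ Y, IsCompact (U y)
  graph_closed : IsClosed {p : (Fin n → ℝ) × Uc | p.1 ∈ Y ∧ p.2 ∈ U p.1}
  f_bounded : ∃ C : ℝ, ∀ y ∈ Y, ∀ (u : Uc) (s : S), ‖f y u s‖ ≤ C
  f_cont : ∀ s : S, ContinuousOn (fun p : (Fin n → ℝ) × Uc => f p.1 p.2 s) (Y ×ˢ univ)
  f_meas : ∀ y ∈ Y, ∀ u : Uc, Measurable fun s => f y u s
  f_inv : ∀ y ∈ Y, ∀ u ∈ U y, ∀ s : S, f y u s ∈ Y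

variable {n : ℕ} {Uc S : Type} [MetricSpace Uc] [CompactSpace Uc] [MeasurableSpace Uc]
  [BorelSpace Uc] [TopologicalSpace S] [PolishSpace S] [MeasurableSpace S] [BorelSpace S]

/-- A control plan: a sequence of Borel measurable selections of the multifunction `U`. -/
structure Plan (M : Model n Uc S) where
  π : ℕ → (Fin n → ℝ) → Uc
  measurable : ∀ t, Measurable (π t)
  feasible : ∀ t, ∀ y ∈ M.Y, π t y ∈ M.U y

/-- The law of the state `y^{π,y₀}(t)` of the controlled stochastic recursion started at
`y₀` and driven by the i.i.d. noise with common law `ν`, defined by the Markov recursion.  -/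
def stateLaw (M : Model n Uc S) (t : ℕ) :
    (ℕ → (Fin n → ℝ) → Uc) → (Fin n → ℝ) → Measure (Fin n → ℝ) :=
  Nat.rec (motive := fun _ => (ℕ → (Fin n → ℝ) → Uc) → (Fin n → ℝ) → Measure (Fin n → ℝ))
    (fun _ y => Measure.dirac y)
    (fun _ ih π y =>
      (M.ν.map fun s => M.f y (π 0 y) s).bind fun y' => ih (fun j => π (j + 1)) y') t

/-- The joint law of the state-control pair `(y^{π,y₀}(t), u^{π,y₀}(t))`. -/
def saLaw (M : Model n Uc S) (t : ℕ) (π : ℕ → (Fin n → ℝ) → Uc) (y0 : Fin n → ℝ) :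
    Measure ((Fin n → ℝ) × Uc) :=
  (stateLaw M t π y0).map fun z => (z, π t z)

/-- `E[q(y^{π,y₀}(t), u^{π,y₀}(t))]`. -/
def expSA (M : Model n Uc S) (t : ℕ) (π : ℕ → (Fin n → ℝ) → Uc) (y0 : Fin n → ℝ)
    (q : (Fin n → ℝ) → Uc → ℝ) : ℝ :=
  ∫ p, q p.1 p.2 ∂saLaw M t π y0

/-- The finite horizon average expected cost `(1/T) E[Σ_{t=0}^{T-1} k(y(t),u(t))]`. -/
def costT (M : Model n Uc S) (k : (Fin n → ℝ) → Uc → ℝ) (T : ℕ) (π : ℕ → (Fin n → ℝ) → Uc)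
    (y0 : Fin n → ℝ) : ℝ :=
  (1 / (T : ℝ)) * ∑ t ∈ Finset.range T, expSA M t π y0 k

/-- The optimal value `v_T(y₀)` of the finite horizon problem. -/
def vT (M : Model n Uc S) (k : (Fin n → ℝ) → Uc → ℝ) (T : ℕ) (y0 : Fin n → ℝ) : ℝ :=
  ⨅ π : Plan M, costT M k T π.π y0

/-- The expected discounted cost `ε Σ_{t=0}^∞ (1-ε)^t E[k(y(t),u(t))]`. -/
def costDisc (M : Model n Uc S) (k : (Fin n → ℝ) → Uc → ℝ) (ε : ℝ)
    (π : ℕ → (Fin n → ℝ) → Uc) (y0 : Fin n → ℝ) : ℝ :=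
  ε * ∑' t : ℕ, (1 - ε) ^ t * expSA M t π y0 k

/-- The optimal value `h_ε(y₀)` of the discounted problem. -/
def hEps (M : Model n Uc S) (k : (Fin n → ℝ) → Uc → ℝ) (ε : ℝ) (y0 : Fin n → ℝ) : ℝ :=
  ⨅ π : Plan M, costDisc M k ε π.π y0

/-- The graph `G` of the multifunction `U`. -/
def graphG (M : Model n Uc S) : Set ((Fin n → ℝ) × Uc) := {p | p.1 ∈ M.Y ∧ p.2 ∈ M.U p.1}

/-- `E[φ(f(y,u,s))]`, the expectation over the noise of `φ` evaluated after one step. -/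
def Ef (M : Model n Uc S) (φ : (Fin n → ℝ) → ℝ) (y : Fin n → ℝ) (u : Uc) : ℝ :=
  ∫ s, φ (M.f y u s) ∂M.ν

/-- A measure on `Y × Uc` is concentrated on the graph `G` (this encodes measures defined
on Borel subsets of `G`). -/
def onG (M : Model n Uc S) (γ : Measure ((Fin n → ℝ) × Uc)) : Prop := γ (graphG M)ᶜ = 0

/-- The set `W` of stationary measures. -/
def Wset (M : Model n Uc S) : Set (Measure ((Fin n → ℝ) × Uc)) :=
  {γ | IsProbabilityMeasure γ ∧ onG M γ ∧
    ∀ φ : (Fin n → ℝ) → ℝ, Continuous φ → ∫ p, (Ef M φ p.1 p.2 - φ p.1) ∂γ = 0}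

/-- The set `W(ε, y₀)` of discounted stationary measures. -/
def Weps (M : Model n Uc S) (ε : ℝ) (y0 : Fin n → ℝ) : Set (Measure ((Fin n → ℝ) × Uc)) :=
  {γ | IsProbabilityMeasure γ ∧ onG M γ ∧
    ∀ φ : (Fin n → ℝ) → ℝ, Continuous φ →
      ∫ p, ((1 - ε) * (Ef M φ p.1 p.2 - φ p.1) + ε * (φ y0 - φ p.1)) ∂γ = 0}

/-- The optimal value `k*(ε, y₀)` of the IDLP problem over `W(ε, y₀)`. -/
def kStarEps (M : Model n Uc S) (k : (Fin n → ℝ) → Uc → ℝ) (ε : ℝ) (y0 : Fin n → ℝ) : ℝ :=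
  sInf ((fun γ : Measure ((Fin n → ℝ) × Uc) => ∫ p, k p.1 p.2 ∂γ) '' Weps M ε y0)

/-- The optimal value `k*` of the IDLP problem over `W`. -/
def kStar (M : Model n Uc S) (k : (Fin n → ℝ) → Uc → ℝ) : ℝ :=
  sInf ((fun γ : Measure ((Fin n → ℝ) × Uc) => ∫ p, k p.1 p.2 ∂γ) '' Wset M)

/-- The optimal value `μ*(ε, y₀)` of the problem dual to the IDLP problem over `W(ε,y₀)`. -/
def muStarEps (M : Model n Uc S) (k : (Fin n → ℝ) → Uc → ℝ) (ε : ℝ) (y0 : Fin n → ℝ) : ℝ :=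
  sSup {r : ℝ | ∃ ψ : (Fin n → ℝ) → ℝ, Continuous ψ ∧
    r = sInf ((fun p : (Fin n → ℝ) × Uc =>
      k p.1 p.2 + (1 - ε) * (Ef M ψ p.1 p.2 - ψ p.1) + ε * (ψ y0 - ψ p.1)) '' graphG M)}

/-- The optimal value `μ*` of the problem dual to the IDLP problem over `W`. -/
def muStar (M : Model n Uc S) (k : (Fin n → ℝ) → Uc → ℝ) : ℝ :=
  sSup {r : ℝ | ∃ ψ : (Fin n → ℝ) → ℝ, Continuous ψ ∧
    r = sInf ((fun p : (Fin n → ℝ) × Uc => k p.1 p.2 + Ef M ψ p.1 p.2 - ψ p.1) '' graphG M)}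

/-- The feasible set `Ω(y₀)` of the augmented IDLP problem. -/
def OmegaSet (M : Model n Uc S) (y0 : Fin n → ℝ) :
    Set (Measure ((Fin n → ℝ) × Uc) × Measure ((Fin n → ℝ) × Uc)) :=
  {p | p.1 ∈ Wset M ∧ IsFiniteMeasure p.2 ∧ onG M p.2 ∧
    ∀ φ : (Fin n → ℝ) → ℝ, Continuous φ →
      ∫ q, (φ y0 - φ q.1) ∂p.1 + ∫ q, (Ef M φ q.1 q.2 - φ q.1) ∂p.2 = 0}

/-- The optimal value `k*(y₀)` of the augmented IDLP problem. -/
def kStarAug (M : Model n Uc S) (k : (Fin n → ℝ) → Uc → ℝ) (y0 : Fin n → ℝ) : ℝ :=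
  sInf ((fun p : Measure ((Fin n → ℝ) × Uc) × Measure ((Fin n → ℝ) × Uc) =>
    ∫ q, k q.1 q.2 ∂p.1) '' OmegaSet M y0)

/-- Feasibility of `(μ, ψ, η)` for the problem dual to the augmented IDLP problem. -/
def DualFeas (M : Model n Uc S) (k : (Fin n → ℝ) → Uc → ℝ) (y0 : Fin n → ℝ)
    (ψ η : (Fin n → ℝ) → ℝ) (μ : ℝ) : Prop :=
  (∀ p ∈ graphG M, 0 ≤ k p.1 p.2 + (ψ y0 - ψ p.1) + Ef M η p.1 p.2 - η p.1 - μ) ∧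
  (∀ p ∈ graphG M, 0 ≤ Ef M ψ p.1 p.2 - ψ p.1)

/-- The optimal value `d*(y₀)` of the dual (with continuous test functions) of the
augmented IDLP problem. -/
def dStar (M : Model n Uc S) (k : (Fin n → ℝ) → Uc → ℝ) (y0 : Fin n → ℝ) : ℝ :=
  sSup {μ : ℝ | ∃ ψ η : (Fin n → ℝ) → ℝ, Continuous ψ ∧ Continuous η ∧
    DualFeas M k y0 ψ η μ}

/-- Bounded Borel measurable real valued functions. -/
def BddBorel (ψ : (Fin n → ℝ) → ℝ) : Prop := Measurable ψ ∧ ∃ C : ℝ, ∀ y, |ψ y| ≤ C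

/-- The optimal value `d̂*(y₀)` of the relaxed dual (with bounded Borel test functions) of
the augmented IDLP problem. -/
def dHatStar (M : Model n Uc S) (k : (Fin n → ℝ) → Uc → ℝ) (y0 : Fin n → ℝ) : ℝ :=
  sSup {μ : ℝ | ∃ ψ η : (Fin n → ℝ) → ℝ, BddBorel ψ ∧ BddBorel η ∧ DualFeas M k y0 ψ η μ}

/-- The occupational measure `γ^{π,y₀,T}`. -/
def occT (M : Model n Uc S) (T : ℕ) (π : ℕ → (Fin n → ℝ) → Uc) (y0 : Fin n → ℝ) :
    Measure ((Fin n → ℝ) × Uc) :=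
  (T : ℝ≥0∞)⁻¹ • ∑ t ∈ Finset.range T, saLaw M t π y0

/-- The discounted occupational measure `γ_d^{π,y₀,ε}`. -/
def discOcc (M : Model n Uc S) (ε : ℝ) (π : ℕ → (Fin n → ℝ) → Uc) (y0 : Fin n → ℝ) :
    Measure ((Fin n → ℝ) × Uc) :=
  ENNReal.ofReal ε • Measure.sum fun t : ℕ => ENNReal.ofReal (1 - ε) ^ t • saLaw M t π y0

/-- The set `Θ_ε(y₀)` of discounted occupational measures, as a set of probability
measures (carrying the topology of weak convergence). -/
def ThetaEps (M : Model n Uc S) (ε : ℝ) (y0 : Fin n → ℝ) :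
    Set (ProbabilityMeasure ((Fin n → ℝ) × Uc)) :=
  {μ | ∃ π : Plan M, μ.toMeasure = discOcc M ε π.π y0}

/-- `Θ_ε := ∪_{y₀ ∈ Y} Θ_ε(y₀)`. -/
def ThetaEpsAll (M : Model n Uc S) (ε : ℝ) : Set (ProbabilityMeasure ((Fin n → ℝ) × Uc)) :=
  ⋃ y0 ∈ M.Y, ThetaEps M ε y0

/-- The set `Γ_T(y₀)` of occupational measures. -/
def GammaT (M : Model n Uc S) (T : ℕ) (y0 : Fin n → ℝ) :
    Set (ProbabilityMeasure ((Fin n → ℝ) × Uc)) :=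
  {μ | ∃ π : Plan M, μ.toMeasure = occT M T π.π y0}

/-- `Γ_T := ∪_{y₀ ∈ Y} Γ_T(y₀)`. -/
def GammaTAll (M : Model n Uc S) (T : ℕ) : Set (ProbabilityMeasure ((Fin n → ℝ) × Uc)) :=
  ⋃ y0 ∈ M.Y, GammaT M T y0

/-- `W` as a set of probability measures. -/
def WsetPM (M : Model n Uc S) : Set (ProbabilityMeasure ((Fin n → ℝ) × Uc)) :=
  {μ | μ.toMeasure ∈ Wset M}

/-- `W(ε,y₀)` as a set of probability measures. -/
def WepsPM (M : Model n Uc S) (ε : ℝ) (y0 : Fin n → ℝ) :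
    Set (ProbabilityMeasure ((Fin n → ℝ) × Uc)) :=
  {μ | μ.toMeasure ∈ Weps M ε y0}

/-- The set of finite convex combinations of elements of a set of probability measures,
i.e. its convex hull. -/
def convexCombos {α : Type*} [MeasurableSpace α] (A : Set (ProbabilityMeasure α)) :
    Set (ProbabilityMeasure α) :=
  {μ | ∃ (m : ℕ) (w : Fin m → ℝ≥0) (γ : Fin m → ProbabilityMeasure α),
    (∀ i, γ i ∈ A) ∧ (∑ i, w i) = 1 ∧
    μ.toMeasure = ∑ i, (w i : ℝ≥0∞) • (γ i).toMeasure}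

/-- Membership in the set `D₁(y₀)`. -/
def D1mem (M : Model n Uc S) (y0 : Fin n → ℝ) (γ : Measure ((Fin n → ℝ) × Uc)) : Prop :=
  ∃ ξ : ℕ → Measure ((Fin n → ℝ) × Uc),
    (∀ l, IsFiniteMeasure (ξ l) ∧ onG M (ξ l)) ∧
    ∀ φ : (Fin n → ℝ) → ℝ, Continuous φ →
      Tendsto (fun l => ∫ q, (Ef M φ q.1 q.2 - φ q.1) ∂ξ l) atTop
        (𝓝 (∫ q, (φ q.1 - φ y0) ∂γ))

/-- A control plan is periodic regime generating (PRG) for the initial point `y₀`. -/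
def IsPRG (M : Model n Uc S) (π : Plan M) (y0 : Fin n → ℝ) : Prop :=
  ∃ T0 Tp : ℕ, 0 < Tp ∧
    ∀ q : ((Fin n → ℝ) × Uc) → ℝ, Continuous q →
      ∀ t, T0 ≤ t → ∫ p, q p ∂saLaw M t π.π y0 = ∫ p, q p ∂saLaw M (t + Tp) π.π y0

/-- The optimal value `V_per(y₀)` over periodic regime generating control plans. -/
def Vper (M : Model n Uc S) (k : (Fin n → ℝ) → Uc → ℝ) (y0 : Fin n → ℝ) : ℝ :=
  sInf {c : ℝ | ∃ π : Plan M, IsPRG M π y0 ∧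
    Tendsto (fun T => costT M k T π.π y0) atTop (𝓝 c)}

/-- The optimal value `k*_θ(y₀)` of the perturbed augmented IDLP problem. -/
def kStarTheta (M : Model n Uc S) (k θ : (Fin n → ℝ) → Uc → ℝ) (y0 : Fin n → ℝ) : ℝ :=
  sInf ((fun p : Measure ((Fin n → ℝ) × Uc) × Measure ((Fin n → ℝ) × Uc) =>
    ∫ q, k q.1 q.2 ∂p.1 + ∫ q, θ q.1 q.2 ∂p.2) '' OmegaSet M y0)

/-- Feasibility of `(μ, ψ, η)` for the perturbed dual problem. -/
def DualFeasTheta (M : Model n Uc S) (k θ : (Fin n → ℝ) → Uc → ℝ) (y0 : Fin n → ℝ)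
    (ψ η : (Fin n → ℝ) → ℝ) (μ : ℝ) : Prop :=
  (∀ p ∈ graphG M, 0 ≤ k p.1 p.2 + (ψ y0 - ψ p.1) + Ef M η p.1 p.2 - η p.1 - μ) ∧
  (∀ p ∈ graphG M, -θ p.1 p.2 ≤ Ef M ψ p.1 p.2 - ψ p.1)

/-- The optimal value `d*_θ(y₀)` of the perturbed dual problem. -/
def dStarTheta (M : Model n Uc S) (k θ : (Fin n → ℝ) → Uc → ℝ) (y0 : Fin n → ℝ) : ℝ :=
  sSup {μ : ℝ | ∃ ψ η : (Fin n → ℝ) → ℝ, Continuous ψ ∧ Continuous η ∧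
    DualFeasTheta M k θ y0 ψ η μ}

/-- The optimal value `d̄*_θ(y₀)` of the second form of the perturbed dual problem. -/
def dBarTheta (M : Model n Uc S) (k θ : (Fin n → ℝ) → Uc → ℝ) (y0 : Fin n → ℝ) : ℝ :=
  sSup {r : ℝ | ∃ ψ η : (Fin n → ℝ) → ℝ, Continuous ψ ∧ Continuous η ∧ r = ψ y0 ∧
    (∀ p ∈ graphG M, 0 ≤ k p.1 p.2 - ψ p.1 + Ef M η p.1 p.2 - η p.1) ∧
    (∀ p ∈ graphG M, -θ p.1 p.2 ≤ Ef M ψ p.1 p.2 - ψ p.1)}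

section Duality

variable {X : Type*} [TopologicalSpace X]

lemma isOpen_setOf_forall_pos [CompactSpace X] : IsOpen {g : C(X, ℝ) | ∀ x, 0 < g x} := by
  have h := ContinuousMap.isOpen_setOfPred_mapsTo (X := X) (Y := ℝ) isCompact_univ (isOpen_Ioi (a := 0))
  simpa [MapsTo] using h

/-- A linear functional that is nonnegative on strictly positive functions is nonnegative on
nonnegative functions. -/
lemma nonneg_of_pos_of_le (Λ : C(X, ℝ) →L[ℝ] ℝ)
    (hΛ : ∀ g : C(X, ℝ), (∀ x, 0 < g x) → 0 ≤ Λ g) (g : C(X, ℝ)) (hg : ∀ x, 0 ≤ g x) :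
    0 ≤ Λ g := by
  have h1 : 0 ≤ Λ 1 := hΛ 1 fun _ => by simp
  refine le_of_forall_pos_le_add fun δ hδ => ?_
  have h2 : 0 ≤ Λ (g + (δ / (Λ 1 + 1)) • 1) := hΛ _ fun x => by
    have : 0 < δ / (Λ 1 + 1) := by positivity
    have := hg x
    simp
    linarith
  have h3 : δ / (Λ 1 + 1) * Λ 1 ≤ δ := by
    rw [div_mul_eq_mul_div, div_le_iff₀ (by positivity)]
    nlinarith
  simp only [map_add, map_smul, smul_eq_mul] at h2
  linarith

/-- A positive linear functional on `C(X, ℝ)`, `X` compact Hausdorff, is given by integration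
against a finite measure. -/
lemma exists_measure_of_nonneg [CompactSpace X] [T2Space X] [MeasurableSpace X] [BorelSpace X]
    (Λ : C(X, ℝ) →L[ℝ] ℝ) (hΛ : ∀ g : C(X, ℝ), (∀ x, 0 ≤ g x) → 0 ≤ Λ g) :
    ∃ μ : Measure X, IsFiniteMeasure μ ∧ ∀ g : C(X, ℝ), ∫ x, g x ∂μ = Λ g := by
  let L : CompactlySupportedContinuousMap X ℝ →ₚ[ℝ] ℝ := PositiveLinearMap.mk₀
    { toFun := fun g => Λ (g : C(X, ℝ))
      map_add' := fun g h => Λ.map_add _ _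
      map_smul' := fun c g => Λ.map_smul c _ }
    (fun g hg => hΛ _ hg)
  refine ⟨RealRMK.rieszMeasure L, inferInstance, fun g => ?_⟩
  exact RealRMK.integral_rieszMeasure L (CompactlySupportedContinuousMap.continuousMapEquiv g)

/-- If no element of the affine space `k + L` stays strictly above the constant `c`, then some
probability measure annihilates `L` and integrates `k` to at most `c`. -/
lemma exists_probabilityMeasure_annihilating [CompactSpace X] [T2Space X] [MeasurableSpace X]
    [BorelSpace X] (k : C(X, ℝ)) (L : Submodule ℝ C(X, ℝ)) (c : ℝ)
    (hc : ∀ g ∈ L, ∃ x, k x + g x ≤ c) :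
    ∃ μ : Measure X, IsProbabilityMeasure μ ∧ (∀ g ∈ L, ∫ x, g x ∂μ = 0) ∧
      ∫ x, k x ∂μ ≤ c := by
  have hP : Convex ℝ {g : C(X, ℝ) | ∀ x, 0 < g x} := by
    intro g hg h hh a b ha hb hab x
    exact (convex_Ioi (0 : ℝ)) (hg x) (hh x) ha hb hab
  have hT : Convex ℝ ((fun g => (k - c • 1) + g) '' (L : Set C(X, ℝ))) :=
    L.convex.translate (k - c • 1)
  have hdisj : Disjoint {g : C(X, ℝ) | ∀ x, 0 < g x}
      ((fun g => (k - c • 1) + g) '' (L : Set C(X, ℝ))) := by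
    rw [Set.disjoint_left]
    rintro _ hpos ⟨g, hg, rfl⟩
    obtain ⟨x, hx⟩ := hc g hg
    have := hpos x
    simp at this
    linarith
  obtain ⟨F, u, hF, hu⟩ := geometric_hahn_banach_open hP isOpen_setOf_forall_pos hT hdisj
  have hu' : ∀ g ∈ L, u ≤ F (k - c • 1) + F g := fun g hg => by
    rw [← map_add]; exact hu _ ⟨g, hg, rfl⟩
  have hzero : ∀ g ∈ L, F g = 0 := by
    intro g hg
    by_contra hne
    have := hu' (((u - 1 - F (k - c • 1)) / F g) • g) (L.smul_mem _ hg)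
    rw [map_smul, smul_eq_mul, div_mul_cancel₀ _ hne] at this
    linarith
  have hu0 : 0 ≤ u := by
    by_contra! hneg
    have h1 := hF 1 fun _ => by simp
    have h2 := hF ((u / F 1) • 1) fun x => by
      have := div_pos_of_neg_of_neg hneg (h1.trans hneg)
      simpa using this
    rw [map_smul, smul_eq_mul, div_mul_cancel₀ _ (h1.trans hneg).ne] at h2
    exact lt_irrefl _ h2
  have hpos : ∀ g : C(X, ℝ), (∀ x, 0 < g x) → 0 ≤ (-F) g := by
    intro g hg
    by_contra! hneg
    have hFg : 0 < F g := by simpa using hneg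
    have h2 := hF (((u + 1) / F g) • g) fun x => by
      have := hg x
      have h0 : 0 < (u + 1) / F g := by positivity
      simpa using mul_pos h0 this
    rw [map_smul, smul_eq_mul, div_mul_cancel₀ _ hFg.ne'] at h2
    linarith
  obtain ⟨μ, hμ, hint⟩ := exists_measure_of_nonneg (-F) (nonneg_of_pos_of_le _ hpos)
  have hk : u ≤ F k - c * F 1 := by simpa using hu' 0 L.zero_mem
  have hmass : μ.real univ = -F 1 := by simpa using hint 1
  have hF1 : 0 < -F 1 := by
    refine lt_of_le_of_ne (by simpa using hpos 1 fun _ => by simp) fun h => ?_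
    have h1 : F 1 = 0 := by linarith
    have h2 := hF ((k - c • 1) + (‖k - c • 1‖ + 1) • 1) fun x => by
      have := neg_abs_le ((k - c • 1) x)
      have h3 := (k - c • 1).norm_coe_le_norm x
      rw [Real.norm_eq_abs] at h3
      rw [ContinuousMap.add_apply, ContinuousMap.smul_apply, ContinuousMap.one_apply, smul_eq_mul]
      linarith
    rw [map_add, map_smul, h1, smul_zero, add_zero] at h2
    have h3 := hu' 0 L.zero_mem
    rw [map_zero, add_zero] at h3
    linarith
  have : NeZero μ := ⟨fun h => by simp [h] at hmass; linarith⟩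
  refine ⟨(μ univ)⁻¹ • μ, inferInstance, fun g hg => ?_, ?_⟩
  · rw [integral_smul_measure, hint g]
    simp [hzero g hg]
  · rw [integral_smul_measure, hint k, ENNReal.toReal_inv]
    change (μ.real univ)⁻¹ * (-F k) ≤ c
    rw [hmass, inv_mul_le_iff₀ hF1]
    linarith

end Duality

lemma graphG_subset (M : Model n Uc S) : graphG M ⊆ M.Y ×ˢ (univ : Set Uc) :=
  fun _ hp => ⟨hp.1, mem_univ _⟩

lemma isCompact_graphG (M : Model n Uc S) : IsCompact (graphG M) :=
  (M.Y_compact.prod isCompact_univ).of_isClosed_subset M.graph_closed (graphG_subset M)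

lemma graphG_nonempty (M : Model n Uc S) : (graphG M).Nonempty := by
  obtain ⟨y, hy⟩ := M.Y_nonempty
  obtain ⟨u, hu⟩ := M.U_nonempty y hy
  exact ⟨(y, u), hy, hu⟩

lemma exists_bound_comp_f (M : Model n Uc S) {φ : (Fin n → ℝ) → ℝ} (hφ : Continuous φ) :
    ∃ B : ℝ, ∀ y ∈ M.Y, ∀ (u : Uc) (s : S), ‖φ (M.f y u s)‖ ≤ B := by
  obtain ⟨R, hR⟩ := M.f_bounded
  obtain ⟨B, hB⟩ := (isCompact_closedBall (0 : Fin n → ℝ) R).exists_bound_of_continuousOn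
    hφ.continuousOn
  exact ⟨B, fun y hy u s => hB _ (by simpa using hR y hy u s)⟩

lemma integrable_comp_f (M : Model n Uc S) {φ : (Fin n → ℝ) → ℝ} (hφ : Continuous φ)
    {y : Fin n → ℝ} (hy : y ∈ M.Y) (u : Uc) : Integrable (fun s => φ (M.f y u s)) M.ν := by
  have := M.ν_prob
  obtain ⟨B, hB⟩ := exists_bound_comp_f M hφ
  exact .of_bound (hφ.measurable.comp (M.f_meas y hy u)).aestronglyMeasurable B
    (ae_of_all _ (hB y hy u))

lemma continuousOn_Ef (M : Model n Uc S) {φ : (Fin n → ℝ) → ℝ} (hφ : Continuous φ) :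
    ContinuousOn (fun p : (Fin n → ℝ) × Uc => Ef M φ p.1 p.2) (M.Y ×ˢ univ) := by
  have := M.ν_prob
  obtain ⟨B, hB⟩ := exists_bound_comp_f M hφ
  exact continuousOn_of_dominated (bound := fun _ => B)
    (fun p hp => (integrable_comp_f M hφ hp.1 p.2).aestronglyMeasurable)
    (fun p hp => ae_of_all _ (hB p.1 hp.1 p.2)) (integrable_const B)
    (ae_of_all _ fun s => hφ.comp_continuousOn (M.f_cont s))

/-- The generator of the discounted problem applied to the test function `ψ`. -/
def discGen (M : Model n Uc S) (ε : ℝ) (y0 : Fin n → ℝ) (ψ : (Fin n → ℝ) → ℝ)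
    (p : (Fin n → ℝ) × Uc) : ℝ :=
  (1 - ε) * (Ef M ψ p.1 p.2 - ψ p.1) + ε * (ψ y0 - ψ p.1)

lemma continuousOn_discGen (M : Model n Uc S) (ε : ℝ) (y0 : Fin n → ℝ)
    {ψ : (Fin n → ℝ) → ℝ} (hψ : Continuous ψ) :
    ContinuousOn (discGen M ε y0 ψ) (graphG M) := by
  have h := (continuousOn_Ef M hψ).mono (graphG_subset M)
  unfold discGen
  fun_prop

lemma discGen_add (M : Model n Uc S) (ε : ℝ) (y0 : Fin n → ℝ) {φ ψ : (Fin n → ℝ) → ℝ}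
    (hφ : Continuous φ) (hψ : Continuous ψ) {p : (Fin n → ℝ) × Uc} (hp : p ∈ graphG M) :
    discGen M ε y0 (φ + ψ) p = discGen M ε y0 φ p + discGen M ε y0 ψ p := by
  have h : Ef M (φ + ψ) p.1 p.2 = Ef M φ p.1 p.2 + Ef M ψ p.1 p.2 :=
    integral_add (integrable_comp_f M hφ hp.1 p.2) (integrable_comp_f M hψ hp.1 p.2)
  simp only [discGen, h, Pi.add_apply]
  ring

lemma discGen_smul (M : Model n Uc S) (ε : ℝ) (y0 : Fin n → ℝ) (c : ℝ)
    (ψ : (Fin n → ℝ) → ℝ) (p : (Fin n → ℝ) × Uc) :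
    discGen M ε y0 (c • ψ) p = c * discGen M ε y0 ψ p := by
  have h : Ef M (c • ψ) p.1 p.2 = c * Ef M ψ p.1 p.2 := integral_const_mul c _
  simp only [discGen, h, Pi.smul_apply, smul_eq_mul]
  ring

/-- The range of the generator on continuous test functions, as functions on the graph. -/
def genRange (M : Model n Uc S) (ε : ℝ) (y0 : Fin n → ℝ) : Submodule ℝ C(graphG M, ℝ) where
  carrier := {g | ∃ ψ : (Fin n → ℝ) → ℝ, Continuous ψ ∧ ∀ p, g p = discGen M ε y0 ψ p}
  add_mem' := by
    rintro g h ⟨φ, hφ, hg⟩ ⟨ψ, hψ, hh⟩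
    exact ⟨φ + ψ, hφ.add hψ, fun p => by
      rw [discGen_add M ε y0 hφ hψ p.2, ← hg, ← hh, ContinuousMap.add_apply]⟩
  zero_mem' := ⟨0, continuous_zero, fun p => by simp [discGen, Ef]⟩
  smul_mem' := by
    rintro c g ⟨ψ, hψ, hg⟩
    exact ⟨c • ψ, hψ.const_smul c, fun p => by
      rw [discGen_smul, ← hg, ContinuousMap.smul_apply, smul_eq_mul]⟩

/-- The generator is nonpositive at a maximizer of the test function. -/
lemma exists_discGen_nonpos (M : Model n Uc S) {ε : ℝ} (hε : ε ∈ Icc (0 : ℝ) 1)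
    {y0 : Fin n → ℝ} (hy0 : y0 ∈ M.Y) {ψ : (Fin n → ℝ) → ℝ} (hψ : Continuous ψ) :
    ∃ p ∈ graphG M, discGen M ε y0 ψ p ≤ 0 := by
  have := M.ν_prob
  obtain ⟨y, hy, hmax⟩ := M.Y_compact.exists_isMaxOn M.Y_nonempty hψ.continuousOn
  obtain ⟨u, hu⟩ := M.U_nonempty y hy
  refine ⟨(y, u), ⟨hy, hu⟩, ?_⟩
  have h1 : Ef M ψ y u ≤ ψ y := by
    have := integral_mono (integrable_comp_f M hψ hy u) (integrable_const (ψ y))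
      fun s => hmax (M.f_inv y hy u hu s)
    simpa [Ef] using this
  have h2 : ψ y0 ≤ ψ y := hmax hy0
  exact add_nonpos (mul_nonpos_of_nonneg_of_nonpos (by linarith [hε.2]) (by simpa using h1))
    (mul_nonpos_of_nonneg_of_nonpos hε.1 (by simpa using h2))

lemma integrable_of_onG (M : Model n Uc S) {γ : Measure ((Fin n → ℝ) × Uc)}
    [IsFiniteMeasure γ] (hγ : onG M γ) {q : (Fin n → ℝ) × Uc → ℝ}
    (hq : ContinuousOn q (graphG M)) : Integrable q γ := by
  have h := hq.integrableOn_compact (μ := γ) (isCompact_graphG M)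
  rwa [IntegrableOn, Measure.restrict_eq_self_of_ae_mem (s := graphG M) (mem_ae_iff.2 hγ)] at h

lemma muStarEps_eq (M : Model n Uc S) (k : (Fin n → ℝ) → Uc → ℝ) (ε : ℝ)
    (y0 : Fin n → ℝ) :
    muStarEps M k ε y0 = sSup {r : ℝ | ∃ ψ : (Fin n → ℝ) → ℝ, Continuous ψ ∧
      r = sInf ((fun p : (Fin n → ℝ) × Uc =>
        k p.1 p.2 + discGen M ε y0 ψ p) '' graphG M)} := by
  simp only [muStarEps, discGen, add_assoc]

section StrongDuality

variable (M : Model n Uc S) {k : (Fin n → ℝ) → Uc → ℝ}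
  (hk : ContinuousOn (fun p : (Fin n → ℝ) × Uc => k p.1 p.2) (graphG M))

include hk

lemma isCompact_image_lagrangian (ε : ℝ) (y0 : Fin n → ℝ) {ψ : (Fin n → ℝ) → ℝ}
    (hψ : Continuous ψ) :
    IsCompact ((fun p => k p.1 p.2 + discGen M ε y0 ψ p) '' graphG M) :=
  (isCompact_graphG M).image_of_continuousOn (hk.add (continuousOn_discGen M ε y0 hψ))

/-- Weak duality. -/
lemma sInf_lagrangian_le_integral {ε : ℝ} {y0 : Fin n → ℝ} {γ : Measure ((Fin n → ℝ) × Uc)}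
    (hγ : γ ∈ Weps M ε y0) {ψ : (Fin n → ℝ) → ℝ} (hψ : Continuous ψ) :
    sInf ((fun p => k p.1 p.2 + discGen M ε y0 ψ p) '' graphG M) ≤ ∫ p, k p.1 p.2 ∂γ := by
  obtain ⟨hprob, hG, hstat⟩ := hγ
  have hgen := continuousOn_discGen M ε y0 hψ
  have hle : ∀ᵐ p ∂γ, sInf ((fun p => k p.1 p.2 + discGen M ε y0 ψ p) '' graphG M) ≤
      k p.1 p.2 + discGen M ε y0 ψ p := by
    filter_upwards [mem_ae_iff.2 hG] with p hp
    exact csInf_le (isCompact_image_lagrangian M hk ε y0 hψ).bddBelow ⟨p, hp, rfl⟩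
  have h := integral_mono_ae (integrable_const _) (integrable_of_onG M hG (hk.add hgen)) hle
  have h0 : ∫ p, discGen M ε y0 ψ p ∂γ = 0 := hstat ψ hψ
  have hadd := integral_add (integrable_of_onG M hG hk) (integrable_of_onG M hG hgen)
  rw [h0, add_zero] at hadd
  simpa [hadd] using h

lemma bddAbove_dualValues {ε : ℝ} (hε : ε ∈ Icc (0 : ℝ) 1) {y0 : Fin n → ℝ}
    (hy0 : y0 ∈ M.Y) :
    BddAbove {r : ℝ | ∃ ψ : (Fin n → ℝ) → ℝ, Continuous ψ ∧
      r = sInf ((fun p : (Fin n → ℝ) × Uc => k p.1 p.2 + discGen M ε y0 ψ p) '' graphG M)} := by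
  obtain ⟨B, hB⟩ := (isCompact_graphG M).bddAbove_image hk
  refine ⟨B, ?_⟩
  rintro _ ⟨ψ, hψ, rfl⟩
  obtain ⟨p, hp, hle⟩ := exists_discGen_nonpos M hε hy0 hψ
  have h1 := csInf_le (isCompact_image_lagrangian M hk ε y0 hψ).bddBelow ⟨p, hp, rfl⟩
  have h2 := hB ⟨p, hp, rfl⟩
  simp only at h1 h2
  linarith

/-- A feasible measure whose cost does not exceed the dual value. -/
lemma exists_mem_Weps_integral_le {ε : ℝ} (hε : ε ∈ Icc (0 : ℝ) 1) {y0 : Fin n → ℝ}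
    (hy0 : y0 ∈ M.Y) :
    ∃ γ ∈ Weps M ε y0, ∫ p, k p.1 p.2 ∂γ ≤ muStarEps M k ε y0 := by
  have : CompactSpace (graphG M) := isCompact_iff_compactSpace.1 (isCompact_graphG M)
  have hGm : MeasurableSet (graphG M) := (isCompact_graphG M).measurableSet
  have hemb : MeasurableEmbedding (Subtype.val : graphG M → (Fin n → ℝ) × Uc) :=
    .subtype_coe hGm
  obtain ⟨μ, hμ, hL, hkμ⟩ := exists_probabilityMeasure_annihilating
    ⟨_, hk.domRestrict⟩ (genRange M ε y0) (muStarEps M k ε y0) (by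
      rintro g ⟨ψ, hψ, hg⟩
      obtain ⟨p, hp, hpe⟩ := (isCompact_image_lagrangian M hk ε y0 hψ).sInf_mem
        ((graphG_nonempty M).image _)
      refine ⟨⟨p, hp⟩, ?_⟩
      rw [hg, muStarEps_eq]
      exact le_csSup (bddAbove_dualValues M hk hε hy0) ⟨ψ, hψ, hpe⟩)
  refine ⟨μ.map Subtype.val, ⟨?_, ?_, fun ψ hψ => ?_⟩, ?_⟩
  · exact Measure.isProbabilityMeasure_map measurable_subtype_coe.aemeasurable
  · rw [onG, hemb.map_apply]
    simp
  · rw [hemb.integral_map]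
    exact hL ⟨fun p : graphG M => discGen M ε y0 ψ p,
      (continuousOn_discGen M ε y0 hψ).domRestrict⟩ ⟨ψ, hψ, fun _ => rfl⟩
  · rw [hemb.integral_map]
    exact hkμ

lemma kStarEps_eq_muStarEps {ε : ℝ} (hε : ε ∈ Icc (0 : ℝ) 1) {y0 : Fin n → ℝ}
    (hy0 : y0 ∈ M.Y) : kStarEps M k ε y0 = muStarEps M k ε y0 := by
  obtain ⟨γ, hγ, hle⟩ := exists_mem_Weps_integral_le M hk hε hy0
  have hweak : ∀ γ' ∈ Weps M ε y0, muStarEps M k ε y0 ≤ ∫ p, k p.1 p.2 ∂γ' := by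
    intro γ' hγ'
    rw [muStarEps_eq]
    refine csSup_le ⟨_, 0, continuous_zero, rfl⟩ ?_
    rintro _ ⟨ψ, hψ, rfl⟩
    exact sInf_lagrangian_le_integral M hk hγ' hψ
  refine le_antisymm (le_trans (csInf_le ⟨muStarEps M k ε y0, ?_⟩ ⟨γ, hγ, rfl⟩) hle)
    (le_csInf ⟨_, γ, hγ, rfl⟩ ?_)
  · rintro _ ⟨γ', hγ', rfl⟩
    exact hweak γ' hγ'
  · rintro _ ⟨γ', hγ', rfl⟩
    exact hweak γ' hγ'

end StrongDuality

lemma kStar_eq_kStarEps_zero (M : Model n Uc S) (k : (Fin n → ℝ) → Uc → ℝ)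
    (y0 : Fin n → ℝ) : kStar M k = kStarEps M k 0 y0 := by
  simp [kStar, kStarEps, Wset, Weps]

lemma muStar_eq_muStarEps_zero (M : Model n Uc S) (k : (Fin n → ℝ) → Uc → ℝ)
    (y0 : Fin n → ℝ) : muStar M k = muStarEps M k 0 y0 := by
  simp [muStar, muStarEps, add_sub_assoc]

/-- the strong duality equalities `k*(ε,y₀) = μ*(ε,y₀)` for every
`ε ∈ (0,1)` and `y₀ ∈ Y`, and `k* = μ*`. -/
theorem statement1 (M : Model n Uc S) (k : (Fin n → ℝ) → Uc → ℝ)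
    (hk : ContinuousOn (fun p : (Fin n → ℝ) × Uc => k p.1 p.2) (M.Y ×ˢ (univ : Set Uc)))
    (C : ℝ) (hkC : ∀ y ∈ M.Y, ∀ u : Uc, |k y u| ≤ C) :
    (∀ ε ∈ Set.Ioo (0 : ℝ) 1, ∀ y0 ∈ M.Y, kStarEps M k ε y0 = muStarEps M k ε y0) ∧
    kStar M k = muStar M k := by
  have hkG := hk.mono (graphG_subset M)
  refine ⟨fun ε hε y0 hy0 => kStarEps_eq_muStarEps M hkG (Ioo_subset_Icc_self hε) hy0, ?_⟩
  obtain ⟨y0, hy0⟩ := M.Y_nonempty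
  rw [kStar_eq_kStarEps_zero M k y0, muStar_eq_muStarEps_zero M k y0]
  exact kStarEps_eq_muStarEps M hkG ⟨le_rfl, zero_le_one⟩ hy0

end StochLP
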